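/- arXiv:2210.14344 — 6 statements merged into one kernel-verified Lean document; each statement's English description precedes it below -/
import Mathlib

section
/- Fix α ∈ ℂ with α ≠ 0, and let P_α = α·(u₁u₂u₃ + u₄ + u₁³u₂ + u₂³ + u₁u₃²) − u₄² ∈ ℂ[u₁,u₂,u₃,u₄] (so P_α = α·f_α where f_α cuts out the threefold Z_α in the torus). Then there exists a point (u₁,u₂,u₃,u₄) ∈ ℂ⁴ with all four coordinates nonzero at which P_α and all four partial derivatives ∂P_α/∂u_i vanish, if and only if α = α₀. In other words, the affine threefold Z_α = (u₁u₂u₃ + u₄ + u₁³u₂ + u₂³ + u₁u₃² − α⁻¹u₄² = 0) ⊂ (ℂ^×)⁴ is singular if and only if α = α₀. -/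
open MvPolynomial

/-- `P_α = α·(u₁u₂u₃ + u₄ + u₁³u₂ + u₂³ + u₁u₃²) − u₄²`. -/
noncomputable def Ppoly (α : ℂ) : MvPolynomial (Fin 4) ℂ :=
  C α * (X 0 * X 1 * X 2 + X 3 + X 0 ^ 3 * X 1 + X 1 ^ 3 + X 0 * X 2 ^ 2) - X 3 ^ 2

/-- The vanishing of `P_α` and of its partial derivatives, written out in coordinates. -/
theorem singular_Ppoly_iff (α : ℂ) (u : Fin 4 → ℂ) :
    (eval u (Ppoly α) = 0 ∧ ∀ i, eval u (MvPolynomial.pderiv i (Ppoly α)) = 0) ↔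
      α * (u 0 * u 1 * u 2 + u 3 + u 0 ^ 3 * u 1 + u 1 ^ 3 + u 0 * u 2 ^ 2) - u 3 ^ 2 = 0 ∧
      α * (u 1 * u 2 + 3 * u 0 ^ 2 * u 1 + u 2 ^ 2) = 0 ∧
      α * (u 0 * u 2 + u 0 ^ 3 + 3 * u 1 ^ 2) = 0 ∧
      α * (u 0 * u 1 + 2 * u 0 * u 2) = 0 ∧
      α - 2 * u 3 = 0 := by
  simp only [Fin.forall_fin_succ, Ppoly]
  simp [pderiv_X, Pi.single_apply, Derivation.leibniz_pow]
  intro _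
  ring_nf

/-- The threefold `Z_α ⊂ (ℂ^×)⁴` is singular iff `α = α₀ = 5^5/(3^15·2^16)`. -/
theorem stmt4 (α : ℂ) (hα : α ≠ 0) :
    (∃ u : Fin 4 → ℂ, (∀ i, u i ≠ 0) ∧ eval u (Ppoly α) = 0 ∧
        ∀ i, eval u (MvPolynomial.pderiv i (Ppoly α)) = 0) ↔
      α = (5 : ℂ) ^ 5 / (3 ^ 15 * 2 ^ 16) := by
  simp only [singular_Ppoly_iff]
  constructor
  · rintro ⟨u, hu, h, h0, h1, h2, h3⟩
    have ha := hu 0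
    have hc := hu 2
    have hd := hu 3
    generalize u 0 = a at *
    generalize u 1 = b at *
    generalize u 2 = c at *
    generalize u 3 = d at *
    have hb : b = -2 * c := by
      apply mul_left_cancel₀ (mul_ne_zero hα ha)
      linear_combination h2
    subst hb
    have hc' : c = -6 * a ^ 2 := by
      apply mul_left_cancel₀ (mul_ne_zero hα hc)
      linear_combination -h0
    subst hc'
    have ha' : a = 5 / 432 := by
      apply mul_left_cancel₀ (mul_ne_zero hα (pow_ne_zero 3 ha))
      linear_combination h1 / 432
    subst ha'
    have hαd : α = 2 * d := by linear_combination h3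
    subst hαd
    apply mul_left_cancel₀ hd
    linear_combination 2 * h
  · intro h
    refine ⟨![5 / 432, 25 / 15552, -25 / 31104, α / 2], ?_, ?_⟩
    · simp [Fin.forall_fin_succ, hα]
    · subst h
      simp only [Matrix.cons_val]
      norm_num
end

section
/- Fix α ∈ ℂ with α ≠ 0, and let g_α = 4u₁³u₂ + 4u₂³ + α − u₁u₂² ∈ ℂ[u₁,u₂]. Then there exists a point (u₁,u₂) ∈ ℂ² with u₁ ≠ 0 and u₂ ≠ 0 at which g_α, ∂g_α/∂u₁ and ∂g_α/∂u₂ all vanish, if and only if α = α₀. In other words, the discriminant curve Δ = (4u₁³u₂ + 4u₂³ + α − u₁u₂² = 0) ⊂ (ℂ^×)² of the conic bundle π : X_α → (ℂ^×)² is smooth if and only if α ≠ α₀. (At α = α₀ the unique singular torus point is (u₁,u₂) = (5/432, 25/15552).) -/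
open MvPolynomial

/-- `g_α = 4u₁³u₂ + 4u₂³ + α − u₁u₂²`, defining the discriminant curve `Δ_α ⊂ (ℂ^×)²`. -/
noncomputable def gpoly (α : ℂ) : MvPolynomial (Fin 2) ℂ :=
  4 * X 0 ^ 3 * X 1 + 4 * X 1 ^ 3 + C α - X 0 * X 1 ^ 2

theorem eval_gpoly (α : ℂ) (u : Fin 2 → ℂ) :
    eval u (gpoly α) = 4 * u 0 ^ 3 * u 1 + 4 * u 1 ^ 3 + α - u 0 * u 1 ^ 2 := by
  simp [gpoly]

theorem eval_pderiv_zero_gpoly (α : ℂ) (u : Fin 2 → ℂ) :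
    eval u (pderiv 0 (gpoly α)) = 12 * u 0 ^ 2 * u 1 - u 1 ^ 2 := by
  have h4 : (4 : MvPolynomial (Fin 2) ℂ) = C 4 := (map_ofNat C 4).symm
  simp [gpoly, h4, Derivation.leibniz, Derivation.leibniz_pow, pderiv_X]
  ring

theorem eval_pderiv_one_gpoly (α : ℂ) (u : Fin 2 → ℂ) :
    eval u (pderiv 1 (gpoly α)) = 4 * u 0 ^ 3 + 12 * u 1 ^ 2 - 2 * u 0 * u 1 := by
  have h4 : (4 : MvPolynomial (Fin 2) ℂ) = C 4 := (map_ofNat C 4).symm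
  simp [gpoly, h4, Derivation.leibniz, Derivation.leibniz_pow, pderiv_X]
  ring

/-- The discriminant curve `Δ_α ⊂ (ℂ^×)²` is singular iff `α = α₀ = 5^5/(3^15·2^16)`. -/
theorem stmt5 (α : ℂ) (hα : α ≠ 0) :
    (∃ u : Fin 2 → ℂ, (∀ i, u i ≠ 0) ∧ eval u (gpoly α) = 0 ∧
        ∀ i, eval u (MvPolynomial.pderiv i (gpoly α)) = 0) ↔
      α = (5 : ℂ) ^ 5 / (3 ^ 15 * 2 ^ 16) := by
  simp only [Fin.forall_fin_two, eval_gpoly, eval_pderiv_zero_gpoly, eval_pderiv_one_gpoly]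
  constructor
  · rintro ⟨u, ⟨hx, hy⟩, hg, h0, h1⟩
    have hu1 : u 1 = 12 * u 0 ^ 2 := mul_left_cancel₀ hy (by linear_combination -h0)
    rw [hu1] at hg h1
    have hu0 : u 0 = 5 / 432 :=
      mul_left_cancel₀ (pow_ne_zero 3 hx) (by linear_combination h1 / 1728)
    rw [hu0] at hg
    linear_combination hg
  · rintro rfl
    refine ⟨![5 / 432, 25 / 15552], ?_⟩
    norm_num
end

section
/- Fix α ∈ ℂ with α ≠ 0, and let h_α = 4α³u₁⁶u₂ + 4u₂³ + α − αu₁²u₂² ∈ ℂ[u₁,u₂]. Then there exists a point (u₁,u₂) ∈ ℂ² with u₁ ≠ 0 and u₂ ≠ 0 at which h_α, ∂h_α/∂u₁ and ∂h_α/∂u₂ all vanish, if and only if α = α₀. In other words, the double-cover curve Δ̃ = (4α³u₁⁶u₂ + 4u₂³ + α − αu₁²u₂² = 0) ⊂ (ℂ^×)² is smooth if and only if α ≠ α₀. -/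
open MvPolynomial

/-- `h_α = 4α³u₁⁶u₂ + 4u₂³ + α − αu₁²u₂²`, defining the double-cover curve `Δ̃_α ⊂ (ℂ^×)²`. -/
noncomputable def hpoly (α : ℂ) : MvPolynomial (Fin 2) ℂ :=
  C (4 * α ^ 3) * X 0 ^ 6 * X 1 + 4 * X 1 ^ 3 + C α - C α * X 0 ^ 2 * X 1 ^ 2

theorem eval_hpoly (α : ℂ) (u : Fin 2 → ℂ) :
    eval u (hpoly α) =
      4 * α ^ 3 * u 0 ^ 6 * u 1 + 4 * u 1 ^ 3 + α - α * u 0 ^ 2 * u 1 ^ 2 := by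
  simp [hpoly]

theorem hpoly_eq_C_coeff (α : ℂ) :
    hpoly α =
      C (4 * α ^ 3) * X 0 ^ 6 * X 1 + C 4 * X 1 ^ 3 + C α - C α * X 0 ^ 2 * X 1 ^ 2 := by
  simp [hpoly, ← map_ofNat C 4]

theorem eval_pderiv_zero_hpoly (α : ℂ) (u : Fin 2 → ℂ) :
    eval u (pderiv 0 (hpoly α)) =
      2 * α * u 0 * u 1 * (12 * α ^ 2 * (u 0 ^ 2) ^ 2 - u 1) := by
  simp [hpoly_eq_C_coeff, Derivation.leibniz, Derivation.leibniz_pow, pderiv_X]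
  ring

theorem eval_pderiv_one_hpoly (α : ℂ) (u : Fin 2 → ℂ) :
    eval u (pderiv 1 (hpoly α)) =
      4 * α ^ 3 * u 0 ^ 6 + 12 * u 1 ^ 2 - 2 * α * u 0 ^ 2 * u 1 := by
  simp [hpoly_eq_C_coeff, Derivation.leibniz, Derivation.leibniz_pow, pderiv_X]
  ring

/-- The double-cover curve `Δ̃_α ⊂ (ℂ^×)²` is singular iff `α = α₀ = 5^5/(3^15·2^16)`. -/
theorem stmt6 (α : ℂ) (hα : α ≠ 0) :
    (∃ u : Fin 2 → ℂ, (∀ i, u i ≠ 0) ∧ eval u (hpoly α) = 0 ∧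
        ∀ i, eval u (MvPolynomial.pderiv i (hpoly α)) = 0) ↔
      α = (5 : ℂ) ^ 5 / (3 ^ 15 * 2 ^ 16) := by
  simp only [Fin.forall_fin_two, eval_hpoly, eval_pderiv_zero_hpoly, eval_pderiv_one_hpoly]
  constructor
  · rintro ⟨u, ⟨h0, h1⟩, h, hd0, hd1⟩
    have hy : u 1 = 12 * α ^ 2 * (u 0 ^ 2) ^ 2 := by
      have hne : 2 * α * u 0 * u 1 ≠ 0 := by simp [hα, h0, h1]
      exact (sub_eq_zero.mp ((mul_eq_zero.mp hd0).resolve_left hne)).symm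
    obtain ⟨t, ht⟩ : ∃ t, t = α * u 0 ^ 2 := ⟨_, rfl⟩
    have ht0 : t ≠ 0 := by simp [ht, hα, h0]
    have hyt : u 1 = 12 * t ^ 2 := by rw [hy, ht]; ring
    have ht' : t = 5 / 432 := by
      have : t ^ 3 * (1728 * t - 20) = 0 := by
        rw [hyt] at hd1
        rw [← hd1, ht]; ring
      have := (mul_eq_zero.mp this).resolve_left (pow_ne_zero 3 ht0)
      linear_combination this / 1728
    have hα' : α = 96 * t ^ 5 - 6912 * t ^ 6 := by
      rw [hyt] at h
      have h' : 4 * t ^ 3 * (12 * t ^ 2) + 4 * (12 * t ^ 2) ^ 3 + α - t * (12 * t ^ 2) ^ 2 = 0 := by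
        rw [← h]; nth_rewrite 1 [ht]; nth_rewrite 3 [ht]; ring
      linear_combination h'
    rw [hα', ht']
    norm_num
  · intro h
    obtain ⟨r, hr⟩ := IsAlgClosed.exists_pow_nat_eq (5 / (432 * α)) (n := 2) two_pos
    have hrα : α * r ^ 2 = 5 / 432 := by rw [hr]; field_simp
    have hr0 : r ≠ 0 := by
      rintro rfl
      norm_num at hrα
    refine ⟨![r, 25 / 15552], ⟨by simpa using hr0, by norm_num⟩, ?_, ?_, ?_⟩ <;>
      simp only [Matrix.cons_val_zero, Matrix.cons_val_one]
    · calc _ = 4 * (α * r ^ 2) ^ 3 * (25 / 15552) + 4 * (25 / 15552) ^ 3 + α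
            - (α * r ^ 2) * (25 / 15552) ^ 2 := by ring
        _ = 0 := by rw [hrα, h]; norm_num
    · calc _ = 2 * α * r * (25 / 15552) * (12 * (α * r ^ 2) ^ 2 - 25 / 15552) := by ring
        _ = 0 := by rw [hrα]; norm_num
    · calc _ = 4 * (α * r ^ 2) ^ 3 + 12 * (25 / 15552) ^ 2
            - 2 * (α * r ^ 2) * (25 / 15552) := by ring
        _ = 0 := by rw [hrα]; norm_num
end

section
/- Fix α ∈ ℂ with α ≠ 0, and let F_α = 4u₁³u₂ + 4u₀u₂³ + αu₀⁴ − u₀u₁u₂² ∈ ℂ[u₀,u₁,u₂] (a homogeneous quartic). Then there exists a nonzero point (u₀,u₁,u₂) ∈ ℂ³ ∖ {0} at which F_α and all three partial derivatives ∂F_α/∂u₀, ∂F_α/∂u₁, ∂F_α/∂u₂ vanish, if and only if α = α₀. In other words, the plane quartic curve N_α = (F_α = 0) ⊂ ℙ² is smooth if and only if α ≠ α₀. -/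
open MvPolynomial

/-- `F_α = 4u₁³u₂ + 4u₀u₂³ + αu₀⁴ − u₀u₁u₂²`, the homogeneous quartic defining `N_α ⊂ ℙ²`. -/
noncomputable def Fpoly (α : ℂ) : MvPolynomial (Fin 3) ℂ :=
  4 * X 1 ^ 3 * X 2 + 4 * X 0 * X 2 ^ 3 + C α * X 0 ^ 4 - X 0 * X 1 * X 2 ^ 2

theorem four_eq_C : (4 : MvPolynomial (Fin 3) ℂ) = C 4 := rfl

theorem eval_Fpoly (α : ℂ) (u : Fin 3 → ℂ) :
    eval u (Fpoly α) =
      4 * u 1 ^ 3 * u 2 + 4 * u 0 * u 2 ^ 3 + α * u 0 ^ 4 - u 0 * u 1 * u 2 ^ 2 := by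
  simp [Fpoly, four_eq_C]

theorem eval_pderiv_zero_Fpoly (α : ℂ) (u : Fin 3 → ℂ) :
    eval u (pderiv 0 (Fpoly α)) = 4 * u 2 ^ 3 + 4 * α * u 0 ^ 3 - u 1 * u 2 ^ 2 := by
  simp [Fpoly, four_eq_C, pderiv_X, Derivation.leibniz_pow]
  ring

theorem eval_pderiv_one_Fpoly (α : ℂ) (u : Fin 3 → ℂ) :
    eval u (pderiv 1 (Fpoly α)) = 12 * u 1 ^ 2 * u 2 - u 0 * u 2 ^ 2 := by
  simp [Fpoly, four_eq_C, pderiv_X, Derivation.leibniz_pow]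
  ring

theorem eval_pderiv_two_Fpoly (α : ℂ) (u : Fin 3 → ℂ) :
    eval u (pderiv 2 (Fpoly α)) =
      4 * u 1 ^ 3 + 12 * u 0 * u 2 ^ 2 - 2 * u 0 * u 1 * u 2 := by
  simp [Fpoly, four_eq_C, pderiv_X, Derivation.leibniz_pow]
  ring

/-- The plane quartic `N_α ⊂ ℙ²` is singular iff `α = α₀ = 5^5/(3^15·2^16)`. -/
theorem stmt7 (α : ℂ) (hα : α ≠ 0) :
    (∃ u : Fin 3 → ℂ, u ≠ 0 ∧ eval u (Fpoly α) = 0 ∧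
        ∀ i, eval u (MvPolynomial.pderiv i (Fpoly α)) = 0) ↔
      α = (5 : ℂ) ^ 5 / (3 ^ 15 * 2 ^ 16) := by
  simp only [Fin.forall_fin_succ, IsEmpty.forall_iff, and_true,
    Fin.succ_zero_eq_one, Fin.succ_one_eq_two, eval_Fpoly, eval_pderiv_zero_Fpoly,
    eval_pderiv_one_Fpoly, eval_pderiv_two_Fpoly]
  constructor
  · rintro ⟨u, hu, -, h0, h1, h2⟩
    have hc : u 2 ≠ 0 := by
      intro hc
      have hb : u 1 = 0 := by simpa [hc] using h2
      have ha : u 0 = 0 := by simpa [hc, hα] using h0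
      exact hu (by ext i; fin_cases i <;> simp [ha, hb, hc])
    have hac : u 0 * u 2 = 12 * u 1 ^ 2 :=
      mul_right_cancel₀ hc (by linear_combination -h1)
    have hb0 : u 1 ≠ 0 := by
      intro hb
      have ha : u 0 = 0 := by simpa [hb, hc] using hac
      simp [ha, hb, hc] at h0
    have hb : u 1 = 36 / 5 * u 2 :=
      mul_left_cancel₀ (pow_ne_zero 2 hb0)
        (by linear_combination (-1 / 20) * h2 + (12 * u 2 - 2 * u 1) / 20 * hac)
    have ha : u 0 = 15552 / 25 * u 2 :=
      mul_right_cancel₀ hc (by rw [hac, hb]; ring)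
    rw [ha, hb] at h0
    apply mul_right_cancel₀ (pow_ne_zero 3 hc)
    linear_combination (25 / 15552) ^ 3 / 4 * h0
  · rintro rfl
    refine ⟨![15552 / 25, 36 / 5, 1], fun h => ?_, ?_⟩
    · simpa using congrFun h 2
    · simp only [Matrix.cons_val]
      norm_num
end

section
/- Let m₁,…,m₆ ∈ ℤ⁴ be the columns of the matrix [[1,0,0,3,0,1],[1,0,0,1,3,0],[1,0,0,0,0,2],[0,2,1,0,0,0]], i.e. m₁=(1,1,1,0), m₂=(0,0,0,2), m₃=(0,0,0,1), m₄=(3,1,0,0), m₅=(0,3,0,0), m₆=(1,0,2,0), and let γ = (−18,−1,2,3,5,9) ∈ ℤ⁶. Then for l = (l₁,…,l₆) ∈ ℤ⁶ one has (Σ_{i=1}^{6} l_i = 0 and Σ_{i=1}^{6} l_i·m_i = 0 in ℤ⁴) if and only if l is an integer multiple of γ. That is, the lattice of integral affine relations among m₁,…,m₆ (equivalently, of integral relations among the vectors (1,m_i) ∈ ℤ⁵) is exactly ℤ·γ. -/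
/-- The exponent vectors `m₁,…,m₆ ∈ ℤ⁴`. -/
def mvec : Fin 6 → Fin 4 → ℤ :=
  ![![1, 1, 1, 0], ![0, 0, 0, 2], ![0, 0, 0, 1], ![3, 1, 0, 0], ![0, 3, 0, 0], ![1, 0, 2, 0]]

/-- The gamma list `γ = (−18,−1,2,3,5,9)`. -/
def gammaList : Fin 6 → ℤ := ![-18, -1, 2, 3, 5, 9]

/-- The lattice of integral affine relations among `m₁,…,m₆` is exactly `ℤ·γ`. -/
theorem stmt9 (l : Fin 6 → ℤ) :
    ((∑ i, l i = 0) ∧ (∑ i, l i • mvec i) = 0) ↔ ∃ k : ℤ, l = k • gammaList := by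
  constructor
  · rintro ⟨hsum, hrel⟩
    have h0 := congrFun hrel 0
    have h1 := congrFun hrel 1
    have h2 := congrFun hrel 2
    have h3 := congrFun hrel 3
    simp [Fin.sum_univ_succ, mvec] at hsum h0 h1 h2 h3
    refine ⟨-l 1, funext fun i => ?_⟩
    fin_cases i <;> simp [gammaList] <;> grind
  · rintro ⟨k, rfl⟩
    constructor
    · simp [Fin.sum_univ_succ, gammaList]
      ring
    · ext j
      fin_cases j <;> simp [Fin.sum_univ_succ, gammaList, mvec] <;> ring
end

section
/- Fix α ∈ ℂ with α ≠ 0. Define φ : (ℂ^×)⁴ → (ℂ^×)⁴ by φ(u₁,u₂,u₃,u₄) = (v₁,v₂,v₃,v₄) with v₁ = u₄/(u₁u₂u₃), v₂ = u₁²/u₃, v₃ = u₂²/(u₁u₃), v₄ = u₃/u₂. Then: (a) φ is a bijection of (ℂ^×)⁴ onto itself; and (b) for every (u₁,u₂,u₃,u₄) ∈ (ℂ^×)⁴, u₁u₂u₃ · (1 + v₁ + v₂ + v₃ + v₄ − α⁻¹·v₁²v₂³v₃⁵v₄⁹) = u₁u₂u₃ + u₄ + u₁³u₂ + u₂³ +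 u₁u₃² − α⁻¹u₄². In particular, φ identifies the hypersurface (1 + v₁ + v₂ + v₃ + v₄ − α⁻¹v₁²v₂³v₃⁵v₄⁹ = 0) ⊂ (ℂ^×)⁴ with the threefold Z_α = (u₁u₂u₃ + u₄ + u₁³u₂ + u₂³ + u₁u₃² − α⁻¹u₄² = 0) ⊂ (ℂ^×)⁴. -/
/-- The monomial change of coordinates `φ : (ℂ^×)⁴ → (ℂ^×)⁴`,
`φ(u₁,u₂,u₃,u₄) = (u₄/(u₁u₂u₃), u₁²/u₃, u₂²/(u₁u₃), u₃/u₂)`. -/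
def phiMap (u : ℂˣ × ℂˣ × ℂˣ × ℂˣ) : ℂˣ × ℂˣ × ℂˣ × ℂˣ :=
  (u.2.2.2 / (u.1 * u.2.1 * u.2.2.1),
   u.1 ^ 2 / u.2.2.1,
   u.2.1 ^ 2 / (u.1 * u.2.2.1),
   u.2.2.1 / u.2.1)

/-- The inverse monomial map of `phiMap`. -/
def phiInv (v : ℂˣ × ℂˣ × ℂˣ × ℂˣ) : ℂˣ × ℂˣ × ℂˣ × ℂˣ :=
  (v.2.1 * v.2.2.1 * v.2.2.2 ^ 2,
   v.2.1 * v.2.2.1 ^ 2 * v.2.2.2 ^ 3,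
   v.2.1 * v.2.2.1 ^ 2 * v.2.2.2 ^ 4,
   v.1 * v.2.1 ^ 3 * v.2.2.1 ^ 5 * v.2.2.2 ^ 9)

theorem phiInv_leftInverse : Function.LeftInverse phiInv phiMap := by
  rintro ⟨a, b, c, d⟩
  simp only [phiInv, phiMap, Prod.mk.injEq]
  refine ⟨?_, ?_, ?_, ?_⟩ <;> ext <;> push_cast <;> field_simp

theorem phiInv_rightInverse : Function.RightInverse phiInv phiMap := by
  rintro ⟨a, b, c, d⟩
  simp only [phiInv, phiMap, Prod.mk.injEq]
  refine ⟨?_, ?_, ?_, ?_⟩ <;> ext <;> push_cast <;> field_simp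

/-- `φ` is a bijection of `(ℂ^×)⁴` identifying the standard toric hypersurface of
`γ = (−18,−1,2,3,5,9)` with the threefold `Z_α`. -/
theorem stmt12 (α : ℂ) (hα : α ≠ 0) :
    Function.Bijective phiMap ∧
    ∀ u : ℂˣ × ℂˣ × ℂˣ × ℂˣ,
      ((u.1 : ℂ) * u.2.1 * u.2.2.1) *
          (1 + ((phiMap u).1 : ℂ) + ((phiMap u).2.1 : ℂ) + ((phiMap u).2.2.1 : ℂ)
            + ((phiMap u).2.2.2 : ℂ)
            - α⁻¹ * ((phiMap u).1 : ℂ) ^ 2 * ((phiMap u).2.1 : ℂ) ^ 3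
              * ((phiMap u).2.2.1 : ℂ) ^ 5 * ((phiMap u).2.2.2 : ℂ) ^ 9)
        = (u.1 : ℂ) * u.2.1 * u.2.2.1 + u.2.2.2 + (u.1 : ℂ) ^ 3 * u.2.1
          + (u.2.1 : ℂ) ^ 3 + (u.1 : ℂ) * (u.2.2.1 : ℂ) ^ 2
          - α⁻¹ * (u.2.2.2 : ℂ) ^ 2 := by
  refine ⟨⟨phiInv_leftInverse.injective, phiInv_rightInverse.surjective⟩, ?_⟩
  rintro ⟨a, b, c, d⟩
  simp only [phiMap]
  push_cast
  field_simp
end
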